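/- arXiv:math/0610611 — 3 statements merged into one kernel-verified Lean document; each statement's English description precedes it below -/
import Mathlib

section
/- Let K be a compact subset of ℂⁿ (n ≥ 1) and K̂ its polynomial hull. Then the complement ℂⁿ \ K̂ is a connected (and nonempty) open set. -/
/-- Evaluation of a multivariate polynomial with complex coefficients at a point of ℂⁿ. -/
noncomputable def polyEval {n : ℕ} (P : MvPolynomial (Fin n) ℂ)
    (z : EuclideanSpace ℂ (Fin n)) : ℂ :=
  MvPolynomial.eval (fun i => z i) P

/-- The polynomial hull of a set `K ⊆ ℂⁿ`. -/
noncomputable def polynomialHull {n : ℕ} (K : Set (EuclideanSpace ℂ (Fin n))) :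
    Set (EuclideanSpace ℂ (Fin n)) :=
  {z | ∀ P : MvPolynomial (Fin n) ℂ, ‖polyEval P z‖ ≤ ⨆ w : K, ‖polyEval P w‖}

open Set Metric Bornology

/-- In a real normed space of dimension at least two, the complement of a closed ball centred at
the origin is preconnected. -/
lemma isPreconnected_compl_closedBall_zero {E : Type*} [NormedAddCommGroup E] [NormedSpace ℝ E]
    (h : 1 < Module.rank ℝ E) {r : ℝ} (hr : 0 ≤ r) :
    IsPreconnected (closedBall (0 : E) r)ᶜ := by
  have himage : (closedBall (0 : E) r)ᶜ =
      (fun p : ℝ × E => p.1 • p.2) '' (Ioi r ×ˢ sphere (0 : E) 1) := by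
    ext x
    simp only [mem_compl_iff, mem_closedBall, dist_zero_right, not_le, mem_image, mem_prod,
      mem_Ioi, mem_sphere, Prod.exists]
    constructor
    · intro hx
      have hx0 : ‖x‖ ≠ 0 := (hr.trans_lt hx).ne'
      refine ⟨‖x‖, ‖x‖⁻¹ • x, ⟨hx, ?_⟩, smul_inv_smul₀ hx0 x⟩
      rw [norm_smul, norm_inv, norm_norm, inv_mul_cancel₀ hx0]
    · rintro ⟨t, y, ⟨ht, hy⟩, rfl⟩
      rwa [norm_smul, hy, mul_one, Real.norm_of_nonneg (hr.trans ht.le)]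
  rw [himage]
  exact (isPreconnected_Ioi.prod (isPreconnected_sphere h 0 1)).image _
    continuous_smul.continuousOn

/-- The frontier of a connected component of an open set does not meet that set. -/
lemma IsOpen.disjoint_frontier_connectedComponentIn {X : Type*} [TopologicalSpace X]
    [LocallyConnectedSpace X] {V : Set X} (hV : IsOpen V) (x : X) :
    Disjoint (frontier (connectedComponentIn V x)) V := by
  rw [Set.disjoint_left]
  intro w hw hwV
  rw [hV.connectedComponentIn.frontier_eq] at hw
  obtain ⟨y, hyw, hyx⟩ := mem_closure_iff.1 hw.1 _ (hV.connectedComponentIn (x := w))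
    (mem_connectedComponentIn hwV)
  apply hw.2
  rw [connectedComponentIn_eq hyx, ← connectedComponentIn_eq hyw]
  exact mem_connectedComponentIn hwV

/-- A set that has bounded complement and has no bounded component is
preconnected. -/
lemma isPreconnected_of_unbounded_components {E : Type*} [NormedAddCommGroup E]
    [NormedSpace ℝ E] (h : 1 < Module.rank ℝ E) {V : Set E} (hVc : IsBounded Vᶜ)
    (hunb : ∀ x ∈ V, ¬ IsBounded (connectedComponentIn V x)) : IsPreconnected V := by
  obtain ⟨r, hr, hVr⟩ := hVc.subset_closedBall_lt 0 0
  have hsub : (closedBall (0 : E) r)ᶜ ⊆ V := compl_subset_comm.1 hVr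
  have hball := isPreconnected_compl_closedBall_zero h hr.le
  have hmem : ∀ x ∈ V, ∃ y ∈ (closedBall (0 : E) r)ᶜ, y ∈ connectedComponentIn V x := by
    intro x hx
    by_contra! hcon
    exact hunb x hx (isBounded_closedBall.subset fun y hy => by_contra fun hy' => hcon y hy' hy)
  refine isPreconnected_of_forall_pair fun x hx y hy => ?_
  obtain ⟨a, ha, hax⟩ := hmem x hx
  obtain ⟨b, hb, hby⟩ := hmem y hy
  refine ⟨connectedComponentIn V x, connectedComponentIn_subset V x,
    mem_connectedComponentIn hx, ?_, isPreconnected_connectedComponentIn⟩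
  have hbx : b ∈ connectedComponentIn V x := by
    rw [connectedComponentIn_eq hax]
    exact hball.subset_connectedComponentIn ha hsub hb
  rw [connectedComponentIn_eq hbx, ← connectedComponentIn_eq hby]
  exact mem_connectedComponentIn hy

lemma differentiable_polyEval {n : ℕ} (P : MvPolynomial (Fin n) ℂ) :
    Differentiable ℂ (polyEval P) := by
  unfold polyEval
  induction P using MvPolynomial.induction_on with
  | C a => simp
  | add p q hp hq =>
    simp only [map_add]
    exact hp.add hq
  | mul_X p i hp =>
    simp only [map_mul, MvPolynomial.eval_X]
    exact hp.mul (by fun_prop)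

lemma isClosed_polynomialHull {n : ℕ} (K : Set (EuclideanSpace ℂ (Fin n))) :
    IsClosed (polynomialHull K) := by
  simp only [polynomialHull, ofPred_forall]
  exact isClosed_iInter fun P =>
    isClosed_le (differentiable_polyEval P).continuous.norm continuous_const

lemma isBounded_polynomialHull {n : ℕ} (K : Set (EuclideanSpace ℂ (Fin n))) :
    IsBounded (polynomialHull K) := by
  have hcoord : IsBounded (WithLp.ofLp '' polynomialHull K) := by
    rw [← forall_isBounded_image_eval_iff]
    refine fun i => isBounded_iff_forall_norm_le.2
      ⟨⨆ w : K, ‖polyEval (MvPolynomial.X i) (w : EuclideanSpace ℂ (Fin n))‖, ?_⟩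
    rintro _ ⟨_, ⟨z, hz, rfl⟩, rfl⟩
    simpa [polyEval] using hz (MvPolynomial.X i)
  refine ((PiLp.antilipschitzWith_ofLp 2 fun _ : Fin n => ℂ).isBounded_preimage hcoord).subset ?_
  exact subset_preimage_image _ _

/-- No component of the complement of a polynomial hull is bounded, by the maximum principle. -/
lemma not_isBounded_component_compl_polynomialHull {n : ℕ}
    [Nontrivial (EuclideanSpace ℂ (Fin n))] {K : Set (EuclideanSpace ℂ (Fin n))}
    {z : EuclideanSpace ℂ (Fin n)} (hz : z ∈ (polynomialHull K)ᶜ) :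
    ¬ IsBounded (connectedComponentIn (polynomialHull K)ᶜ z) := by
  intro hb
  have hdisj :=
    (isClosed_polynomialHull K).isOpen_compl.disjoint_frontier_connectedComponentIn z
  exact hz fun P => Complex.norm_le_of_forall_mem_frontier_norm_le hb
    (differentiable_polyEval P).diffContOnCl
    (fun w hw => disjoint_compl_right_iff_subset.1 hdisj hw P)
    (subset_closure (mem_connectedComponentIn hz))

/-- For a compact `K ⊆ ℂⁿ` (n ≥ 1), the complement of the polynomial hull is a
nonempty connected open set. -/
theorem stmt_2 {n : ℕ} (hn : 1 ≤ n) (K : Set (EuclideanSpace ℂ (Fin n)))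
    (hK : IsCompact K) :
    IsOpen (polynomialHull K)ᶜ ∧ IsConnected (polynomialHull K)ᶜ := by
  have : Nonempty (Fin n) := ⟨⟨0, hn⟩⟩
  have : Nontrivial (EuclideanSpace ℂ (Fin n)) := inferInstance
  have hbdd := isBounded_polynomialHull K
  have hrank : 1 < Module.rank ℝ (EuclideanSpace ℂ (Fin n)) := by
    apply Module.one_lt_rank_of_one_lt_finrank
    rw [finrank_real_of_complex, finrank_euclideanSpace_fin]
    omega
  refine ⟨(isClosed_polynomialHull K).isOpen_compl, ?_, ?_⟩
  · rw [nonempty_compl]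
    intro huniv
    exact NormedSpace.unbounded_univ ℂ (EuclideanSpace ℂ (Fin n)) (huniv ▸ hbdd)
  · exact isPreconnected_of_unbounded_components hrank (by rwa [compl_compl])
      fun z hz => not_isBounded_component_compl_polynomialHull hz
end

section
/- Let U ⊆ ℂ be an open connected set and f : U → ℂⁿ a complex analytic map. Suppose the image f(U) is contained in a finite union L₁ ∪ ⋯ ∪ L_m of affine complex lines in ℂⁿ (sets of the form {a + t·b : t ∈ ℂ} with b ≠ 0). If f is nonconstant, then there is a single index i with f(U) ⊆ L_i. -/
/-- If an analytic map on a preconnected set takes values in the translate `a +ᵥ S` of a closed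
subspace frequently near a point of the set, then it does so on the whole set. -/
theorem AnalyticOnNhd.sub_mem_of_frequently_sub_mem {𝕜 F : Type*} [NontriviallyNormedField 𝕜]
    [NormedAddCommGroup F] [NormedSpace 𝕜 F]
    {f : 𝕜 → F} {U : Set 𝕜} {S : Submodule 𝕜 F} {a : F} {z₀ : 𝕜}
    (hf : AnalyticOnNhd 𝕜 f U) (hU : IsPreconnected U) (hS : IsClosed (S : Set F)) (hz₀ : z₀ ∈ U)
    (h : ∃ᶠ z in nhdsWithin z₀ {z₀}ᶜ, f z - a ∈ S) : ∀ z ∈ U, f z - a ∈ S := by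
  have : IsClosed (S : Set F) := hS
  have hg : AnalyticOnNhd 𝕜 (fun z => S.mkQL (f z - a)) U :=
    S.mkQL.comp_analyticOnNhd (hf.sub analyticOnNhd_const)
  have hzero := hg.eqOn_zero_of_preconnected_of_frequently_eq_zero hU hz₀
    (h.mono fun z hz => (Submodule.Quotient.mk_eq_zero S).2 hz)
  exact fun z hz => (Submodule.Quotient.mk_eq_zero S).1 (hzero hz)

/-- A nonconstant analytic map of a connected open set `U ⊆ ℂ` into ℂⁿ whose image lies
in a finite union of affine complex lines has image in a single one of the lines. -/
theorem stmt_5 {n : ℕ} (U : Set ℂ) (hU : IsOpen U) (hUconn : IsConnected U)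
    (f : ℂ → EuclideanSpace ℂ (Fin n)) (hf : AnalyticOnNhd ℂ f U)
    (m : ℕ) (L : Fin m → Set (EuclideanSpace ℂ (Fin n)))
    (hL : ∀ i, ∃ a b : EuclideanSpace ℂ (Fin n), b ≠ 0 ∧
      L i = {z | ∃ t : ℂ, z = a + t • b})
    (himg : f '' U ⊆ ⋃ i, L i)
    (hnonconst : ¬ ∃ c, ∀ z ∈ U, f z = c) :
    ∃ i, f '' U ⊆ L i := by
  obtain ⟨z₀, hz₀⟩ := hUconn.nonempty
  have hev : ∀ᶠ z in nhdsWithin z₀ {z₀}ᶜ, ∃ i, f z ∈ L i :=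
    (eventually_nhdsWithin_of_eventually_nhds (hU.mem_nhds hz₀)).mono fun z hz =>
      Set.mem_iUnion.1 (himg ⟨z, hz, rfl⟩)
  obtain ⟨i, hi⟩ : ∃ i, ∃ᶠ z in nhdsWithin z₀ {z₀}ᶜ, f z ∈ L i := by
    by_contra! hne
    obtain ⟨z, ⟨i, hi⟩, hz⟩ := (hev.and (Filter.eventually_all.2 hne)).exists
    exact hz i hi
  obtain ⟨a, b, -, hLi⟩ := hL i
  have hmem : ∀ w, w ∈ L i ↔ w - a ∈ Submodule.span ℂ {b} := fun w => by
    simp only [hLi, Set.mem_ofPred_eq, Submodule.mem_span_singleton, eq_sub_iff_add_eq', eq_comm]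
  refine ⟨i, ?_⟩
  rintro _ ⟨z, hz, rfl⟩
  exact (hmem _).2 <| hf.sub_mem_of_frequently_sub_mem hUconn.isPreconnected
    (Submodule.closed_of_finiteDimensional _) hz₀ (hi.mono fun w => (hmem _).1) z hz
end

section
/- Let F : ℂ → ℂⁿ be complex analytic on a neighborhood of the closed unit disk, and let φ : ℂⁿ → ℝ be a smooth function that is plurisubharmonic, i.e. D²φ(z)(v,v) + D²φ(z)(i·v, i·v) ≥ 0 for every z, v ∈ ℂⁿ, where D²φ(z) is the second real Fréchet derivative of φ at z, viewed as a symmetric bilinear form. Set G(t) = F(e^{2πit}). Then ∫₀¹ Dφ(G(t))[(−i)·G′(t)] dt ≥ 0, where Dφ denotes the real Fréchet derivative of φ. -/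
open MeasureTheory Set

/-- The real derivative of `p ↦ Dφ(F(z(p)))[a(p) F'(z(p))]` for `F` holomorphic. -/
theorem exists_hasFDerivAt_fderiv_comp_smul_deriv {X E : Type*} [NormedAddCommGroup X]
    [NormedSpace ℝ X] [NormedAddCommGroup E] [NormedSpace ℂ E] [NormedSpace ℝ E]
    [IsScalarTower ℝ ℂ E] [CompleteSpace E] {φ : E → ℝ} (hφ : ContDiff ℝ 2 φ)
    {F : ℂ → E} {z a : X → ℂ} {z' a' : X →L[ℝ] ℂ} {p : X} (hF : AnalyticAt ℂ F (z p))
    (hz : HasFDerivAt z z' p) (ha : HasFDerivAt a a' p) :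
    ∃ L : X →L[ℝ] ℝ,
      HasFDerivAt (fun q => fderiv ℝ φ (F (z q)) (a q • deriv F (z q))) L p ∧
      ∀ h, L h = fderiv ℝ (fderiv ℝ φ) (F (z p)) (z' h • deriv F (z p)) (a p • deriv F (z p)) +
        fderiv ℝ φ (F (z p)) (a' h • deriv F (z p) + (a p * z' h) • deriv (deriv F) (z p)) := by
  have hFz : HasFDerivAt (fun q => F (z q)) _ p :=
    (hF.differentiableAt.hasDerivAt.hasFDerivAt.restrictScalars ℝ).comp p hz
  have hF'z : HasFDerivAt (fun q => deriv F (z q)) _ p :=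
    (hF.deriv.differentiableAt.hasDerivAt.hasFDerivAt.restrictScalars ℝ).comp p hz
  have hD : HasFDerivAt (fderiv ℝ φ) (fderiv ℝ (fderiv ℝ φ) (F (z p))) (F (z p)) :=
    ((hφ.fderiv_right (m := 1) (by norm_num)).differentiable one_ne_zero _).hasFDerivAt
  refine ⟨_, (hD.comp p hFz).clm_apply (ha.smul hF'z), fun h => ?_⟩
  simp [mul_smul, add_comm]

theorem hasFDerivAt_polar (c : ℂ) (p : ℝ × ℝ) :
    ∃ L : ℝ × ℝ →L[ℝ] ℂ,
      HasFDerivAt (fun q : ℝ × ℝ => (q.1 : ℂ) * Complex.exp (c * (q.2 : ℂ))) L p ∧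
      L (1, 0) = Complex.exp (c * p.2) ∧ L (0, 1) = c * (p.1 * Complex.exp (c * p.2)) := by
  have h1 : HasFDerivAt (fun q : ℝ × ℝ => (q.1 : ℂ)) _ p :=
    Complex.ofRealCLM.hasFDerivAt.comp p hasFDerivAt_fst
  have h2 : HasFDerivAt (fun q : ℝ × ℝ => (q.2 : ℂ)) _ p :=
    Complex.ofRealCLM.hasFDerivAt.comp p hasFDerivAt_snd
  refine ⟨_, h1.mul (h2.const_mul c).cexp, ?_, ?_⟩ <;> simp
  ring

theorem hasFDerivAt_exp_snd (c : ℂ) (p : ℝ × ℝ) :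
    ∃ L : ℝ × ℝ →L[ℝ] ℂ,
      HasFDerivAt (fun q : ℝ × ℝ => Complex.exp (c * (q.2 : ℂ))) L p ∧
      L (1, 0) = 0 ∧ L (0, 1) = c * Complex.exp (c * p.2) := by
  have h2 : HasFDerivAt (fun q : ℝ × ℝ => (q.2 : ℂ)) _ p :=
    Complex.ofRealCLM.hasFDerivAt.comp p hasFDerivAt_snd
  refine ⟨_, (h2.const_mul c).cexp, ?_, ?_⟩ <;> simp
  ring

/-- The flux of the gradient of a subharmonic function `φ ∘ F` through the unit circle is
nonnegative. -/
theorem integral_fderiv_smul_deriv_nonneg {E : Type*} [NormedAddCommGroup E] [NormedSpace ℂ E]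
    [NormedSpace ℝ E] [IsScalarTower ℝ ℂ E] [CompleteSpace E] {F : ℂ → E}
    (hF : AnalyticOnNhd ℂ F (Metric.closedBall 0 1)) {φ : E → ℝ} (hφ : ContDiff ℝ 2 φ)
    (hpsh : ∀ z v, 0 ≤ fderiv ℝ (fderiv ℝ φ) z v v +
      fderiv ℝ (fderiv ℝ φ) z (Complex.I • v) (Complex.I • v)) :
    0 ≤ ∫ t in (0 : ℝ)..1,
      fderiv ℝ φ (F (Complex.exp (2 * (Real.pi : ℂ) * Complex.I * (t : ℂ))))
        ((2 * (Real.pi : ℂ) * Complex.exp (2 * (Real.pi : ℂ) * Complex.I * (t : ℂ))) •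
          deriv F (Complex.exp (2 * (Real.pi : ℂ) * Complex.I * (t : ℂ)))) := by
  set c : ℂ := 2 * (Real.pi : ℂ) * Complex.I with hc
  let e : ℝ × ℝ → ℂ := fun q => Complex.exp (c * (q.2 : ℂ))
  let z : ℝ × ℝ → ℂ := fun q => (q.1 : ℂ) * e q
  let f : ℝ × ℝ → ℝ := fun q =>
    fderiv ℝ φ (F (z q)) ((2 * (Real.pi : ℂ) * z q) • deriv F (z q))
  let g : ℝ × ℝ → ℝ := fun q => fderiv ℝ φ (F (z q)) ((Complex.I * e q) • deriv F (z q))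
  let lap : ℝ × ℝ → ℝ := fun q => 2 * Real.pi * q.1 *
    (fderiv ℝ (fderiv ℝ φ) (F (z q)) (e q • deriv F (z q)) (e q • deriv F (z q)) +
      fderiv ℝ (fderiv ℝ φ) (F (z q)) (Complex.I • e q • deriv F (z q))
        (Complex.I • e q • deriv F (z q)))
  let R : Set (ℝ × ℝ) := uIcc 0 1 ×ˢ uIcc 0 1
  have hR1 : ∀ q ∈ R, 0 ≤ q.1 ∧ q.1 ≤ 1 := fun q hq => by
    have := hq.1
    rwa [uIcc_of_le zero_le_one] at this
  have hnorm : ∀ t : ℝ, ‖Complex.exp (c * (t : ℂ))‖ = 1 := fun t => by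
    rw [hc, show 2 * (Real.pi : ℂ) * Complex.I * t = ((2 * Real.pi * t : ℝ) : ℂ) * Complex.I by
      push_cast; ring, Complex.norm_exp_ofReal_mul_I]
  have hzR : MapsTo z R (Metric.closedBall 0 1) := fun q hq => by
    obtain ⟨h0, h1⟩ := hR1 q hq
    rw [mem_closedBall_zero_iff, norm_mul, hnorm, mul_one, Complex.norm_real,
      Real.norm_of_nonneg h0]
    exact h1
  have key : ∀ q ∈ R, HasFDerivAt f (fderiv ℝ f q) q ∧ HasFDerivAt g (fderiv ℝ g q) q ∧
      fderiv ℝ f q (1, 0) + fderiv ℝ g q (0, 1) = lap q := by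
    intro q hq
    obtain ⟨z', hz, hz1, hz2⟩ := hasFDerivAt_polar c q
    obtain ⟨e', he, he1, he2⟩ := hasFDerivAt_exp_snd c q
    obtain ⟨Lf, hLf, hf⟩ := exists_hasFDerivAt_fderiv_comp_smul_deriv hφ (hF _ (hzR hq)) hz
      (hz.const_mul (2 * (Real.pi : ℂ)))
    obtain ⟨Lg, hLg, hg⟩ := exists_hasFDerivAt_fderiv_comp_smul_deriv hφ (hF _ (hzR hq)) hz
      (he.const_mul Complex.I)
    have hLf' : HasFDerivAt f Lf q := hLf
    have hLg' : HasFDerivAt g Lg q := hLg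
    refine ⟨hLf'.differentiableAt.hasFDerivAt, hLg'.differentiableAt.hasFDerivAt, ?_⟩
    rw [hLf'.fderiv, hLg'.fderiv, hf, hg, add_add_add_comm, ← map_add]
    simp only [smul_apply, hz1, hz2, he2, smul_eq_mul]
    change fderiv ℝ (fderiv ℝ φ) (F (z q)) (e q • deriv F (z q))
        ((2 * (Real.pi : ℂ) * z q) • deriv F (z q)) +
      fderiv ℝ (fderiv ℝ φ) (F (z q)) ((c * z q) • deriv F (z q))
        ((Complex.I * e q) • deriv F (z q)) +
      fderiv ℝ φ (F (z q)) ((2 * (Real.pi : ℂ) * e q) • deriv F (z q) +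
        (2 * (Real.pi : ℂ) * z q * e q) • deriv (deriv F) (z q) +
        ((Complex.I * (c * e q)) • deriv F (z q) +
        (Complex.I * e q * (c * z q)) • deriv (deriv F) (z q))) = lap q
    have hI := Complex.I_mul_I
    have h0 : (2 * (Real.pi : ℂ) * e q) • deriv F (z q) +
        (2 * (Real.pi : ℂ) * z q * e q) • deriv (deriv F) (z q) +
        ((Complex.I * (c * e q)) • deriv F (z q) +
        (Complex.I * e q * (c * z q)) • deriv (deriv F) (z q)) = 0 := by
      rw [show Complex.I * (c * e q) = -(2 * (Real.pi : ℂ) * e q) by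
          rw [hc]; linear_combination 2 * (Real.pi : ℂ) * e q * hI,
        show Complex.I * e q * (c * z q) = -(2 * (Real.pi : ℂ) * z q * e q) by
          rw [hc]; linear_combination 2 * (Real.pi : ℂ) * e q * z q * hI]
      module
    have h1 : (2 * (Real.pi : ℂ) * z q) • deriv F (z q) =
        (2 * Real.pi * q.1) • e q • deriv F (z q) := by
      rw [← algebraMap_smul ℂ (2 * Real.pi * q.1), smul_smul]
      simp [z, mul_assoc]
    have h2 : (c * z q) • deriv F (z q) =
        (2 * Real.pi * q.1) • Complex.I • e q • deriv F (z q) := by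
      rw [← algebraMap_smul ℂ (2 * Real.pi * q.1), smul_smul, smul_smul]
      congr 1
      simp [z, hc]
      ring
    rw [h0, h1, h2, mul_smul Complex.I]
    simp only [map_smul, map_zero, smul_apply, smul_eq_mul, lap]
    ring
  have he_cont : Continuous e := by fun_prop
  have hz_cont : Continuous z := by fun_prop
  have hFz : ContinuousOn (fun q => F (z q)) R :=
    hF.continuousOn.comp hz_cont.continuousOn hzR
  have hF'z : ContinuousOn (fun q => deriv F (z q)) R :=
    hF.deriv.continuousOn.comp hz_cont.continuousOn hzR
  have hD2 : ContinuousOn (fun q => fderiv ℝ (fderiv ℝ φ) (F (z q))) R :=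
    ((hφ.fderiv_right (m := 1) (by norm_num)).continuous_fderiv one_ne_zero).comp_continuousOn hFz
  have hlap : ContinuousOn lap R := by
    have hv : ContinuousOn (fun q => e q • deriv F (z q)) R := he_cont.continuousOn.smul hF'z
    have hIv := hv.const_smul Complex.I
    exact (continuous_const.mul continuous_fst).continuousOn.mul
      (((hD2.clm_apply hv).clm_apply hv).add ((hD2.clm_apply hIv).clm_apply hIv))
  have hsub : Ioo (min (0 : ℝ) 1) (max 0 1) ×ˢ Ioo (min (0 : ℝ) 1) (max 0 1) ⊆ R :=
    prod_mono Ioo_subset_Icc_self Ioo_subset_Icc_self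
  have hdiv := integral2_divergence_prod_of_hasFDerivAt f g (fderiv ℝ f) (fderiv ℝ g) 0 0 1 1
    (fun q hq => (key q hq).1.continuousAt.continuousWithinAt)
    (fun q hq => (key q hq).2.1.continuousAt.continuousWithinAt)
    (fun q hq => (key q (hsub hq)).1) (fun q hq => (key q (hsub hq)).2.1)
    ((hlap.integrableOn_compact (isCompact_uIcc.prod isCompact_uIcc)).congr_fun
      (fun q hq => (key q hq).2.2.symm) (measurableSet_uIcc.prod measurableSet_uIcc))
  have hper : ∀ x : ℝ, g (x, 1) = g (x, 0) := fun x => by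
    simp [g, z, e, hc, Complex.exp_two_pi_mul_I]
  have hzero : ∀ y : ℝ, f (0, y) = 0 := fun y => by simp [f, z]
  simp only [hper, hzero, sub_self, zero_add, intervalIntegral.integral_zero, sub_zero] at hdiv
  have hone : ∀ y : ℝ, f (1, y) = fderiv ℝ φ (F (Complex.exp (c * (y : ℂ))))
      ((2 * (Real.pi : ℂ) * Complex.exp (c * (y : ℂ))) •
        deriv F (Complex.exp (c * (y : ℂ)))) := fun y => by simp [f, z, e]
  simp only [hone] at hdiv
  rw [← hdiv]
  refine intervalIntegral.integral_nonneg zero_le_one fun x hx =>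
    intervalIntegral.integral_nonneg zero_le_one fun y hy => ?_
  rw [← uIcc_of_le zero_le_one] at hx hy
  have hq : (x, y) ∈ R := ⟨hx, hy⟩
  rw [(key _ hq).2.2]
  exact mul_nonneg (mul_nonneg (by positivity) (hR1 _ hq).1) (hpsh _ _)

/-- For a holomorphic disk `F` (analytic on a neighborhood of the closed unit disk) and a
smooth plurisubharmonic function `φ` on ℂⁿ, the boundary integral `∫_Γ d^cφ` is
nonnegative, where `Γ` is the boundary loop `G(t) = F(e^{2πit})`. -/
theorem stmt_8 {n : ℕ} (F : ℂ → EuclideanSpace ℂ (Fin n))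
    (hF : AnalyticOnNhd ℂ F (Metric.closedBall 0 1))
    (φ : EuclideanSpace ℂ (Fin n) → ℝ) (hφ : ContDiff ℝ (⊤ : ℕ∞) φ)
    (hpsh : ∀ z v, 0 ≤ fderiv ℝ (fderiv ℝ φ) z v v +
      fderiv ℝ (fderiv ℝ φ) z (Complex.I • v) (Complex.I • v)) :
    0 ≤ ∫ t in (0:ℝ)..1,
        fderiv ℝ φ (F (Complex.exp (2 * (Real.pi : ℂ) * Complex.I * (t : ℂ))))
          ((-Complex.I) •
            deriv (fun s : ℝ => F (Complex.exp (2 * (Real.pi : ℂ) * Complex.I * (s : ℂ)))) t) := by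
  have hφ2 : ContDiff ℝ 2 φ := mod_cast contDiff_infty.1 hφ 2
  refine (integral_fderiv_smul_deriv_nonneg hF hφ2 hpsh).trans_eq
    (intervalIntegral.integral_congr fun t _ => ?_)
  have hmem : Complex.exp (2 * (Real.pi : ℂ) * Complex.I * (t : ℂ)) ∈
      Metric.closedBall (0 : ℂ) 1 := by
    rw [mem_closedBall_zero_iff, show 2 * (Real.pi : ℂ) * Complex.I * t =
      ((2 * Real.pi * t : ℝ) : ℂ) * Complex.I by push_cast; ring, Complex.norm_exp_ofReal_mul_I]
  have hexp : HasDerivAt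
      (fun s : ℝ => Complex.exp (2 * (Real.pi : ℂ) * Complex.I * (s : ℂ)))
      (Complex.exp (2 * (Real.pi : ℂ) * Complex.I * (t : ℂ)) *
        (2 * (Real.pi : ℂ) * Complex.I * 1)) t :=
    ((hasDerivAt_id t).ofReal_comp.const_mul _).cexp
  have hG := (hF _ hmem).differentiableAt.hasDerivAt.scomp t hexp
  have hderiv := hG.deriv
  simp only [Function.comp_def] at hderiv
  simp only [hderiv, smul_smul]
  congr 2
  linear_combination (2 * (Real.pi : ℂ) *
    Complex.exp (2 * (Real.pi : ℂ) * Complex.I * (t : ℂ))) * Complex.I_mul_I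
end
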